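/- Let R be a commutative ring (not necessarily Noetherian), N a Noetherian R-module, and I an ideal of R that is not contained in any minimal prime ideal over Ann_R N. Then Ass_R R/(I^{n+1})^{(N)}_a = Ass_R (I^n)^{(N)}_a/(I^{n+1})^{(N)}_a for all integers n ≥ 0; consequently the sequence Ass_R (I^n)^{(N)}_a/(I^{n+1})^{(N)}_a, n = 1, 2, …, is increasing and ultimately constant. -/

import Mathlib

open Pointwise

section Defs

variable {R : Type} [CommRing R]

/-- `x` is integrally dependent on the ideal `I` relative to the module `N`:
`x ^ n • N ⊆ ∑_{i=1}^n x^(n-i) • (I^i • N)` for some `n ≥ 1`. -/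
def Ideal.RelIntDep (I : Ideal R) (N : Type) [AddCommGroup N] [Module R N] (x : R) : Prop :=
  ∃ n : ℕ, 0 < n ∧ ∀ m : N, x ^ n • m ∈
    ⨆ i ∈ Finset.Icc 1 n, x ^ (n - i) • (I ^ i • (⊤ : Submodule R N))

/-- The integral closure `I^{(N)}_a` of `I` relative to `N`, as a subset of `R`. -/
def Ideal.relIntClosure (I : Ideal R) (N : Type) [AddCommGroup N] [Module R N] : Set R :=
  {x | I.RelIntDep N x}

/-- The classical integral closure `I_a` of an ideal, as a subset of `R`. -/
def Ideal.intClosure (I : Ideal R) : Set R :=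
  {x | ∃ n : ℕ, 0 < n ∧ ∃ r : ℕ → R, (∀ i ∈ Finset.Icc 1 n, r i ∈ I ^ i) ∧
    x ^ n + ∑ i ∈ Finset.Icc 1 n, r i * x ^ (n - i) = 0}

/-- `mAss_R N`: the set of minimal members of `Ass_R N`. -/
def mAss (R : Type) [CommRing R] (N : Type) [AddCommGroup N] [Module R N] : Set (Ideal R) :=
  {p | Minimal (· ∈ associatedPrimes R N) p}

/-- `Ass_R (R/J)` for a subset `J ⊆ R`: primes of the form `(J :_R x)`. -/
def assQuot (J : Set R) : Set (Ideal R) :=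
  {p | p.IsPrime ∧ ∃ x : R, (p : Set R) = {r : R | r * x ∈ J}}

/-- `Ass_R (J/K)` for subsets `K ⊆ J` of `R`: primes of the form `(K :_R x)` with `x ∈ J`. -/
def assQuot₂ (J K : Set R) : Set (Ideal R) :=
  {p | p.IsPrime ∧ ∃ x ∈ J, (p : Set R) = {r : R | r * x ∈ K}}

/-- `S(J) = ∪_{s ∈ S} (J :_R s)`. -/
def sat (S : Set R) (J : Set R) : Set R := {x | ∃ s ∈ S, s * x ∈ J}

/-- `(J :_R K)` for subsets of `R`. -/
def setColon (J K : Set R) : Set R := {x | ∀ y ∈ K, x * y ∈ J}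

/-- `(J :_R ⟨K⟩) = ∪_{n ≥ 1} (J :_R K^n)`. -/
def colonPow (J : Set R) (K : Ideal R) : Set R :=
  {x | ∃ n : ℕ, 0 < n ∧ ∀ y ∈ K ^ n, x * y ∈ J}

end Defs

open Polynomial in
/-- **Cayley–Hamilton** for a finitely generated submodule mapped into `I • M` by a scalar. -/
theorem Submodule.FG.exists_monic_coeff_mem_pow_eval_smul_eq_zero {R N : Type*} [CommRing R]
    [AddCommGroup N] [Module R N] {M : Submodule R N} (hM : M.FG) {I : Ideal R} {x : R}
    (hx : ∀ m ∈ M, x • m ∈ I • M) :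
    ∃ p : R[X], p.Monic ∧ (∀ k, p.coeff k ∈ I ^ (p.natDegree - k)) ∧
      ∀ m ∈ M, p.eval x • m = 0 := by
  have : Module.Finite R M := Module.Finite.iff_fg.mpr hM
  obtain ⟨p, hp, -, hc, h0⟩ :=
    LinearMap.exists_monic_and_natDegree_eq_and_coeff_mem_pow_and_aeval_eq_zero R
      (algebraMap R (Module.End R M) x) I (by
        rintro _ ⟨m, rfl⟩
        rw [Submodule.mem_smul_top_iff]
        exact hx m m.2)
  refine ⟨p, hp, hc, fun m hm ↦ ?_⟩
  rw [aeval_algebraMap_apply] at h0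
  simpa using congrArg (fun g : Module.End R M ↦ (g ⟨m, hm⟩ : N)) h0

namespace Ideal

section Closure

variable {A : Type*} [CommRing A]

/-- The elements `x` for which `x ^ (j + m) ∈ J ^ j` for a fixed `m` and all `j`. In a Noetherian
ring this is the integral closure of `J`. -/
def asympClosure (J : Ideal A) : Ideal A where
  carrier := {x | ∃ m : ℕ, ∀ j : ℕ, x ^ (j + m) ∈ J ^ j}
  zero_mem' := ⟨1, fun j ↦ by simp⟩
  add_mem' := by
    rintro x y ⟨m, hm⟩ ⟨n, hn⟩
    refine ⟨m + n, fun j ↦ ?_⟩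
    rw [add_pow]
    refine _root_.sum_mem fun i hi ↦ mul_mem_right _ _ ?_
    have key : ∀ (z : A) (m : ℕ), (∀ j, z ^ (j + m) ∈ J ^ j) → ∀ i, z ^ i ∈ J ^ (i - m) := by
      intro z m h i
      rcases le_total m i with hi | hi
      · simpa [Nat.sub_add_cancel hi] using h (i - m)
      · simp [Nat.sub_eq_zero_of_le hi]
    refine pow_le_pow_right (m := j) (n := (i - m) + (j + (m + n) - i - n)) ?_ ?_
    · have := Finset.mem_range.mp hi
      omega
    · rw [pow_add]
      exact mul_mem_mul (key x m hm i) (key y n hn _)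
  smul_mem' := by
    rintro r x ⟨m, hm⟩
    refine ⟨m, fun j ↦ ?_⟩
    rw [smul_eq_mul, mul_pow]
    exact mul_mem_left _ _ (hm j)

theorem le_asympClosure (J : Ideal A) : J ≤ J.asympClosure :=
  fun _ hx ↦ ⟨0, fun j ↦ pow_mem_pow hx j⟩

theorem mul_mem_asympClosure_mul {J K : Ideal A} {x y : A} (hx : x ∈ J.asympClosure)
    (hy : y ∈ K) : x * y ∈ (J * K).asympClosure := by
  obtain ⟨m, hm⟩ := hx
  refine ⟨m, fun j ↦ ?_⟩
  rw [mul_pow, mul_pow]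
  exact mul_mem_mul (hm j) (pow_le_pow_right (Nat.le_add_right j m) (pow_mem_pow hy _))

theorem exists_pow_add_le_pow {J B : Ideal A} (hB : B.FG) (h : B ≤ J.asympClosure) :
    ∃ m : ℕ, ∀ j : ℕ, B ^ (j + m) ≤ J ^ j := by
  induction B, hB using Submodule.fg_induction with
  | singleton x =>
    obtain ⟨m, hm⟩ := h (mem_span_singleton_self x)
    refine ⟨m, fun j ↦ ?_⟩
    rw [submodule_span_eq, span_singleton_pow, span_singleton_le_iff_mem]
    exact hm j
  | sup B C hB hC ihB ihC =>
    obtain ⟨m, hm⟩ := ihB (le_sup_left.trans h)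
    obtain ⟨n, hn⟩ := ihC (le_sup_right.trans h)
    refine ⟨m + n, fun j ↦ ?_⟩
    have key : ∀ (B : Ideal A) (m : ℕ), (∀ j, B ^ (j + m) ≤ J ^ j) →
        ∀ i, B ^ i ≤ J ^ (i - m) := by
      intro B m h i
      rcases le_total m i with hi | hi
      · simpa [Nat.sub_add_cancel hi] using h (i - m)
      · simp [Nat.sub_eq_zero_of_le hi]
    rw [← Submodule.add_eq_sup, add_pow]
    refine Finset.sum_induction _ (· ≤ J ^ j) (fun _ _ ↦ sup_le) bot_le fun i hi ↦ ?_
    refine mul_le_left.trans (((mul_mono (key B m hm i) (key C n hn _))).trans ?_)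
    rw [← pow_add]
    refine pow_le_pow_right ?_
    have := Finset.mem_range.mp hi
    omega

theorem exists_pow_succ_le_mul_pow [IsNoetherianRing A] {J B : Ideal A} (hJB : J ≤ B)
    (hB : B ≤ J.asympClosure) : ∃ k : ℕ, B ^ (k + 1) ≤ J * B ^ k := by
  obtain ⟨m, hm⟩ := exists_pow_add_le_pow (IsNoetherian.noetherian B) hB
  let F : J.Filtration A :=
    { N := fun j ↦ B ^ (j + m)
      mono := fun j ↦ pow_le_pow_right (by omega)
      smul_le := fun j ↦ by
        rw [smul_eq_mul, add_right_comm, pow_succ']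
        exact mul_mono_left hJB }
  have hF : F ≤ J.stableFiltration ⊤ := fun j ↦ by
    simpa [F] using hm j
  obtain ⟨n, hn⟩ := (J.stableFiltration_stable ⊤).of_le hF
  refine ⟨n + m, ?_⟩
  have := (hn n le_rfl).ge
  simp only [F, smul_eq_mul] at this
  rwa [add_right_comm]

theorem exists_pow_succ_mem_mul_pow [IsNoetherianRing A] {J : Ideal A} {c : A}
    (hc : c ∈ J.asympClosure) : ∃ k : ℕ, c ^ (k + 1) ∈ J * (J ⊔ span {c}) ^ k := by
  obtain ⟨k, hk⟩ := exists_pow_succ_le_mul_pow (J := J) (B := J ⊔ span {c}) le_sup_left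
    (sup_le J.le_asympClosure ((span_singleton_le_iff_mem _).mpr hc))
  exact ⟨k, hk (pow_mem_pow (mem_sup_right (mem_span_singleton_self c)) _)⟩

theorem sup_pow_succ_le (J C : Ideal A) (k : ℕ) :
    (J ⊔ C) ^ (k + 1) ≤ C ^ (k + 1) ⊔ J * (J ⊔ C) ^ k := by
  induction k with
  | zero => simp
  | succ k ih =>
    rw [pow_succ' _ (k + 1)]
    conv_lhs => rw [sup_mul]
    refine sup_le le_sup_right ((mul_mono_right ih).trans ?_)
    rw [mul_sup, ← pow_succ', mul_left_comm]
    exact sup_le_sup le_rfl (mul_mono_right (by rw [pow_succ']; exact mul_mono_left le_sup_right))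

theorem mem_asympClosure_of_pow_succ_mem {J : Ideal A} {c : A} {k : ℕ}
    (hc : c ^ (k + 1) ∈ J * (J ⊔ span {c}) ^ k) : c ∈ J.asympClosure := by
  set L := J ⊔ span {c} with hL
  have h1 : L ^ (k + 1) ≤ J * L ^ k := by
    refine (sup_pow_succ_le J (span {c}) k).trans (sup_le ?_ le_rfl)
    rwa [span_singleton_pow, span_singleton_le_iff_mem]
  have h2 : ∀ j, L ^ (j + k) ≤ J ^ j * L ^ k := by
    intro j
    induction j with
    | zero => simp
    | succ j ih =>
      calc L ^ (j + 1 + k) = L * L ^ (j + k) := by rw [← pow_succ']; congr 1; omega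
        _ ≤ L * (J ^ j * L ^ k) := mul_mono_right ih
        _ = J ^ j * L ^ (k + 1) := by rw [pow_succ']; ring
        _ ≤ J ^ j * (J * L ^ k) := mul_mono_right h1
        _ = J ^ (j + 1) * L ^ k := by ring
  exact ⟨k, fun j ↦ mul_le_left (h2 j (pow_mem_pow (mem_sup_right (mem_span_singleton_self c)) _))⟩

theorem mem_asympClosure_of_isNilpotent {J : Ideal A} {c q : A} {n : ℕ}
    (hq : q ∈ J * (J ⊔ span {c}) ^ n) (h : IsNilpotent (c ^ (n + 1) - q)) :
    c ∈ J.asympClosure := by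
  obtain ⟨e, he⟩ := h
  set L := J ⊔ span {c} with hL
  have hcL : c ∈ L := mem_sup_right (mem_span_singleton_self c)
  have hqL : c ^ (n + 1) - q ∈ L ^ (n + 1) := by
    refine sub_mem (pow_mem_pow hcL _) ?_
    rw [pow_succ']
    exact mul_mono_left le_sup_left hq
  have key : ∀ e : ℕ, (c ^ (n + 1)) ^ (e + 1) - (c ^ (n + 1) - q) ^ (e + 1) ∈
      J * L ^ ((n + 1) * e + n) := by
    intro e
    induction e with
    | zero => simpa using hq
    | succ e ih =>
      have h1 : (c ^ (n + 1)) ^ (e + 1 + 1) - (c ^ (n + 1) - q) ^ (e + 1 + 1) =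
          ((c ^ (n + 1)) ^ (e + 1) - (c ^ (n + 1) - q) ^ (e + 1)) * c ^ (n + 1) +
            q * (c ^ (n + 1) - q) ^ (e + 1) := by ring
      rw [h1]
      refine add_mem ?_ ?_
      · have := mul_mem_mul ih (pow_mem_pow hcL (n + 1))
        rw [mul_assoc, ← pow_add] at this
        convert this using 3
        ring
      · have := mul_mem_mul hq (pow_mem_pow hqL (e + 1))
        rw [mul_assoc, ← pow_mul, ← pow_add] at this
        convert this using 3
        ring
  refine mem_asympClosure_of_pow_succ_mem (k := (n + 1) * e + n) ?_
  have := key e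
  rw [pow_succ (c ^ (n + 1) - q), he, zero_mul, sub_zero, ← pow_mul] at this
  rwa [add_assoc, ← Nat.mul_succ]

open Polynomial in
theorem mul_eval_sub_pow_mem {K : Ideal A} {p : A[X]} (hp : p.Monic)
    (hc : ∀ k, p.coeff k ∈ K ^ (p.natDegree - k)) (x : A) :
    x * p.eval x - x ^ (p.natDegree + 1) ∈ K * (K ⊔ span {x}) ^ p.natDegree := by
  have hx : x ∈ K ⊔ span {x} := mem_sup_right (mem_span_singleton_self x)
  rw [eval_eq_sum_range, Finset.sum_range_succ, hp.coeff_natDegree, one_mul, mul_add, ← pow_succ',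
    add_sub_cancel_right, Finset.mul_sum]
  refine _root_.sum_mem fun i hi ↦ ?_
  have hi := Finset.mem_range.mp hi
  obtain ⟨e, he⟩ : ∃ e, p.natDegree = i + e + 1 := ⟨p.natDegree - i - 1, by omega⟩
  have h1 : p.coeff i ∈ K * (K ⊔ span {x}) ^ e := by
    have := hc i
    rw [show p.natDegree - i = e + 1 by omega, pow_succ'] at this
    exact mul_mono_right (pow_right_mono le_sup_left e) this
  have := mul_mem_mul h1 (pow_mem_pow hx (i + 1))
  rw [mul_assoc, ← pow_add] at this
  convert this using 1
  · rw [he]; congr 2; ring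
  · ring

theorem mem_asympClosure_pow_of_forall_mul_mem [IsNoetherianRing A] {I : Ideal A}
    (hI : ∀ p ∈ minimalPrimes A, ¬ I ≤ p) {n : ℕ} {c : A}
    (hc : ∀ a ∈ I, c * a ∈ (I ^ (n + 1)).asympClosure) : c ∈ (I ^ n).asympClosure := by
  obtain ⟨k, hk⟩ := exists_pow_succ_le_mul_pow (I ^ (n + 1)).le_asympClosure le_rfl
  set B := (I ^ (n + 1)).asympClosure
  obtain ⟨p, hp, hpc, hp0⟩ := Submodule.FG.exists_monic_coeff_mem_pow_eval_smul_eq_zero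
    (IsNoetherian.noetherian (I * B ^ k)) (I := I ^ n) (x := c) (by
      suffices span {c} * (I * B ^ k) ≤ I ^ n * (I * B ^ k) from fun m hm ↦
        this (mul_mem_mul (mem_span_singleton_self c) hm)
      have h1 : span {c} * I ≤ B := by
        rw [span_singleton_mul_le_iff]
        exact hc
      calc span {c} * (I * B ^ k) = (span {c} * I) * B ^ k := by ring
        _ ≤ B * B ^ k := mul_mono_left h1
        _ = B ^ (k + 1) := by ring
        _ ≤ I ^ (n + 1) * B ^ k := hk
        _ = I ^ n * (I * B ^ k) := by ring)
  have hnil : IsNilpotent (p.eval c) := by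
    rw [← mem_nilradical, nilradical, ← sInf_minimalPrimes, mem_sInf]
    intro q hq
    have hqp : q.IsPrime := hq.1.1
    have h2 : ¬ I ^ (1 + (n + 1) * k) ≤ q := fun h ↦ hI q hq (hqp.le_of_pow_le h)
    obtain ⟨a, ha, haq⟩ := SetLike.not_le_iff_exists.mp h2
    have ha' : a ∈ I * B ^ k := by
      rw [pow_add, pow_one, pow_mul] at ha
      exact mul_mono_right (pow_right_mono (le_asympClosure _) k) ha
    have h3 := hp0 a ha'
    exact (hqp.mem_or_mem (x := p.eval c) (y := a) (by
      rw [← smul_eq_mul, h3]; exact q.zero_mem)).resolve_right haq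
  have h4 := mul_eval_sub_pow_mem hp hpc c
  refine mem_asympClosure_of_isNilpotent (neg_mem h4) ?_
  have : c ^ (p.natDegree + 1) - -(c * p.eval c - c ^ (p.natDegree + 1)) = c * p.eval c := by ring
  rw [this]
  exact (Commute.all _ _).isNilpotent_mul_left hnil

end Closure

end Ideal

namespace Ideal

section AssociatedPrimes

theorem exists_isPrime_colon_mul {A T : Type*} [CommRing A] [CommRing T] [IsNoetherianRing T]
    (φ : A →+* T) (E : Ideal T) {P : Ideal A} [P.IsPrime] {z : T}
    (hz : ∀ s ∉ P, φ s * z ∉ E) :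
    ∃ t : T, (Submodule.colon E {t * z}).IsPrime ∧
      (Submodule.colon E {t * z}).comap φ ≤ P := by
  have hmem : ∀ a w : T, a ∈ Submodule.colon E {w} ↔ a * w ∈ E := fun a w ↦ by
    simp [Submodule.mem_colon_singleton]
  obtain ⟨_, ⟨t, ht, rfl⟩, hmax⟩ := set_has_maximal_iff_noetherian.mpr ‹IsNoetherianRing T›
    {W : Ideal T | ∃ t : T, (∀ s ∉ P, φ s * (t * z) ∉ E) ∧ W = Submodule.colon E {t * z}}
    ⟨_, 1, by simpa using hz, rfl⟩
  have hstep : ∀ b : T, (∀ s ∉ P, φ s * (b * (t * z)) ∉ E) →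
      ∀ a, a * (b * (t * z)) ∈ E → a * (t * z) ∈ E := by
    intro b hb a ha
    by_contra hcon
    refine hmax (Submodule.colon E {b * t * z}) ⟨b * t, by simpa only [mul_assoc] using hb, rfl⟩ ?_
    refine lt_of_le_of_ne (fun w hw ↦ ?_) fun heq ↦ hcon ?_
    · rw [hmem] at hw ⊢
      have := E.mul_mem_left b hw
      convert this using 1
      ring
    · rw [← hmem, heq, hmem, mul_assoc]
      exact ha
  refine ⟨t, ⟨?_, ?_⟩, ?_⟩
  · rw [ne_top_iff_one, hmem]
    simpa using ht 1 (one_notMem P)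
  · intro a b hab
    rw [hmem] at hab
    rw [hmem, hmem]
    by_cases hb : ∀ s ∉ P, φ s * (b * (t * z)) ∉ E
    · exact Or.inl (hstep b hb a (by rwa [← mul_assoc]))
    · push Not at hb
      obtain ⟨s, hs, hsb⟩ := hb
      refine Or.inr (hstep (φ s) (fun s' hs' ↦ ?_) b ?_)
      · rw [← mul_assoc, ← map_mul]
        exact ht _ (fun h ↦ (IsPrime.mem_or_mem ‹_› h).elim hs' hs)
      · rwa [mul_left_comm]
  · intro s hs
    by_contra hsP
    exact ht s hsP ((hmem _ _).mp hs)

theorem finite_isPrime_colon {T : Type*} [CommRing T] [IsNoetherianRing T] (E : Ideal T) :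
    {W : Ideal T | W.IsPrime ∧ ∃ x, W = Submodule.colon E {x}}.Finite := by
  refine (associatedPrimes.finite T (T ⧸ E)).subset ?_
  rintro W ⟨hW, x, rfl⟩
  rw [AssociatedPrimes.mem_iff, IsAssociatedPrime, Submodule.isAssociatedPrime_iff]
  refine ⟨hW, Submodule.Quotient.mk x, ?_⟩
  ext w
  rw [Submodule.mem_colon_singleton, Submodule.mem_colon_singleton, Submodule.mem_bot,
    ← Submodule.Quotient.mk_smul, Submodule.Quotient.mk_eq_zero]

/-- The primes `(I ^ (k + 1) : c)` with `c ∈ I ^ k`. -/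
def gradedAssociatedPrimes {A : Type*} [CommRing A] (I : Ideal A) : Set (Ideal A) :=
  {P | P.IsPrime ∧ ∃ k : ℕ, ∃ c ∈ I ^ k, ∀ r, r ∈ P ↔ r * c ∈ I ^ (k + 1)}

/-- The ideal `I * reesAlgebra I` of the Rees algebra. -/
def reesAlgebraIdeal {A : Type*} [CommRing A] (I : Ideal A) : Ideal (reesAlgebra I) where
  carrier := {f | ∀ k, (f : Polynomial A).coeff k ∈ I ^ (k + 1)}
  zero_mem' := fun k ↦ by simp
  add_mem' := fun hf hg k ↦ by simpa using add_mem (hf k) (hg k)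
  smul_mem' := fun f g hg k ↦ by
    rw [smul_eq_mul, MulMemClass.coe_mul, Polynomial.coeff_mul]
    refine _root_.sum_mem fun ⟨i, j⟩ h ↦ ?_
    rw [← Finset.HasAntidiagonal.mem_antidiagonal.mp h, add_assoc, pow_add]
    exact mul_mem_mul (f.2 i) (hg j)

theorem finite_gradedAssociatedPrimes {A : Type*} [CommRing A] [IsNoetherianRing A]
    (I : Ideal A) : I.gradedAssociatedPrimes.Finite := by
  refine (I.reesAlgebraIdeal.finite_isPrime_colon.image
    (comap (algebraMap A (reesAlgebra I)))).subset ?_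
  rintro P ⟨hP, k, c, hc, hPc⟩
  let z : reesAlgebra I := ⟨Polynomial.monomial k c, reesAlgebra.monomial_mem.mpr hc⟩
  have hz : ∀ r, r ∈ P ↔ algebraMap A (reesAlgebra I) r * z ∈ I.reesAlgebraIdeal := by
    intro r
    rw [hPc]
    change _ ↔ ∀ j, (algebraMap A (Polynomial A) r * Polynomial.monomial k c).coeff j ∈ _
    simp only [Polynomial.algebraMap_apply, Algebra.algebraMap_self, RingHom.id_apply,
      Polynomial.coeff_C_mul, Polynomial.coeff_monomial]
    refine ⟨fun h j ↦ ?_, fun h ↦ by simpa using h k⟩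
    split_ifs with hj
    · exact hj ▸ h
    · simp
  obtain ⟨t, ht, htP⟩ := exists_isPrime_colon_mul (algebraMap A (reesAlgebra I))
    I.reesAlgebraIdeal (P := P) (z := z) (fun s hs ↦ mt (hz s).mpr hs)
  refine ⟨_, ⟨ht, _, rfl⟩, le_antisymm htP fun r hr ↦ ?_⟩
  rw [mem_comap, Submodule.mem_colon_singleton, smul_eq_mul, mul_left_comm]
  exact mul_mem_left _ _ ((hz r).mp hr)

theorem mem_gradedAssociatedPrimes {A : Type*} [CommRing A] {I P : Ideal A} (hP : P.IsPrime)
    {n : ℕ} {c : A} (h : ∀ r, r ∈ P ↔ r * c ∈ I ^ n) : P ∈ I.gradedAssociatedPrimes := by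
  have key : ∀ d k : ℕ, k + d = n → ∀ c ∈ I ^ k, (∀ r, r ∈ P ↔ r * c ∈ I ^ n) →
      P ∈ I.gradedAssociatedPrimes := by
    intro d
    induction d with
    | zero =>
      rintro k rfl c hc h
      exact absurd ((h 1).mpr (by simpa using hc)) (one_notMem P)
    | succ d ih =>
      rintro k hk c hc h
      by_cases hs : ∃ s ∉ P, s * c ∈ I ^ (k + 1)
      · obtain ⟨s, hs, hsc⟩ := hs
        refine ih (k + 1) (by omega) (s * c) hsc fun r ↦ ?_
        rw [← mul_assoc, ← h]
        exact ⟨fun hr ↦ mul_mem_right _ _ hr, fun hr ↦ (hP.mem_or_mem hr).resolve_right hs⟩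
      · push Not at hs
        refine ⟨hP, k, c, hc, fun r ↦ ⟨fun hr ↦ ?_, fun hr ↦ ?_⟩⟩
        · exact pow_le_pow_right (by omega) ((h r).mp hr)
        · by_contra hrP
          exact hs r hrP hr
  exact key n 0 (by simp) c (by simp) h

theorem mem_gradedAssociatedPrimes_of_asympClosure {A : Type*} [CommRing A] [IsNoetherianRing A]
    {I P : Ideal A} (hP : P.IsPrime) {n : ℕ} {c : A}
    (h : ∀ r, r ∈ P ↔ r * c ∈ (I ^ n).asympClosure) : P ∈ I.gradedAssociatedPrimes := by
  by_contra hcon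
  obtain ⟨m, hm⟩ := exists_pow_add_le_pow (IsNoetherian.noetherian (I ^ n).asympClosure) le_rfl
  have h1 : ∀ j : ℕ, ∃ s ∉ P, s * c ^ (j + m) ∈ (I ^ n) ^ j := by
    intro j
    by_contra! hj
    obtain ⟨t, ht, htP⟩ := exists_isPrime_colon_mul (RingHom.id A) ((I ^ n) ^ j) hj
    refine hcon (mem_gradedAssociatedPrimes hP (n := n * j) (c := t * c ^ (j + m)) fun r ↦ ?_)
    rw [pow_mul]
    refine ⟨fun hr ↦ ?_, fun hr ↦ htP (Submodule.mem_colon_singleton.mpr hr)⟩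
    refine Submodule.mem_colon_singleton.mp (ht.mem_of_pow_mem (j + m) ?_)
    rw [Submodule.mem_colon_singleton, smul_eq_mul, mul_left_comm, ← mul_pow]
    exact mul_mem_left _ _ (hm j (pow_mem_pow ((h r).mp hr) _))
  let S := Localization.AtPrime P
  have h2 : algebraMap A S c ∈ ((I ^ n).map (algebraMap A S)).asympClosure := by
    refine ⟨m, fun j ↦ ?_⟩
    rw [← map_pow, ← Ideal.map_pow,
      IsLocalization.algebraMap_mem_map_algebraMap_iff P.primeCompl]
    exact h1 j
  have : IsNoetherianRing S := IsLocalization.isNoetherianRing P.primeCompl S inferInstance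
  obtain ⟨k, hk⟩ := exists_pow_succ_mem_mul_pow h2
  rw [← Set.image_singleton, ← map_span, ← Ideal.map_sup, ← Ideal.map_pow, ← Ideal.map_mul,
    ← map_pow, IsLocalization.algebraMap_mem_map_algebraMap_iff P.primeCompl] at hk
  obtain ⟨s, hs, hsk⟩ := hk
  refine hs ((h s).mpr (mem_asympClosure_of_pow_succ_mem (k := k) ?_))
  have h3 : span {s} * (I ^ n ⊔ span {c}) ≤ I ^ n ⊔ span {s * c} := by
    rw [mul_sup, span_singleton_mul_span_singleton]
    exact sup_le_sup mul_le_right le_rfl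
  have h4 : s ^ k * (s * c ^ (k + 1)) ∈ span {s} ^ k * (I ^ n * (I ^ n ⊔ span {c}) ^ k) :=
    mul_mem_mul (pow_mem_pow (mem_span_singleton_self s) k) hsk
  rw [mul_left_comm, ← mul_pow] at h4
  have h5 := mul_mono_right (pow_right_mono h3 k) h4
  convert h5 using 1
  ring

end AssociatedPrimes

end Ideal

theorem assQuot_eq_assQuot₂_univ {A : Type} [CommRing A] (K : Set A) :
    assQuot K = assQuot₂ Set.univ K := by
  simp [assQuot, assQuot₂]

theorem assQuot₂_mono_left {A : Type} [CommRing A] {J J' : Set A} (h : J ⊆ J') (K : Set A) :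
    assQuot₂ J K ⊆ assQuot₂ J' K :=
  fun _ ⟨hp, x, hx, hpx⟩ ↦ ⟨hp, x, h hx, hpx⟩

theorem assQuot₂_preimage {R A : Type} [CommRing R] [CommRing A] {φ : R →+* A}
    (hφ : Function.Surjective φ) (J : Set A) (K : Ideal A) :
    assQuot₂ (φ ⁻¹' J) (φ ⁻¹' (K : Set A)) = Ideal.comap φ '' assQuot₂ J K := by
  ext p
  constructor
  · rintro ⟨hp, x, hx, hpx⟩
    have hmem : ∀ r, r ∈ p ↔ φ r * φ x ∈ K := fun r ↦ by
      rw [← SetLike.mem_coe, hpx]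
      simp
    have hker : RingHom.ker φ ≤ p := fun r hr ↦ by
      rw [hmem, (RingHom.mem_ker).mp hr, zero_mul]
      exact K.zero_mem
    have hcm : (p.map φ).comap φ = p := by
      rw [Ideal.comap_map_of_surjective' φ hφ, sup_eq_left]
      exact hker
    refine ⟨p.map φ, ⟨Ideal.map_isPrime_of_surjective hφ hker, φ x, hx, ?_⟩, hcm⟩
    ext a
    obtain ⟨r, rfl⟩ := hφ a
    rw [SetLike.mem_coe, ← Ideal.mem_comap, hcm, hmem]
    rfl
  · rintro ⟨P, ⟨hP, y, hy, hPy⟩, rfl⟩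
    obtain ⟨x, rfl⟩ := hφ y
    refine ⟨Ideal.comap_isPrime φ P, x, hy, ?_⟩
    ext r
    rw [SetLike.mem_coe, Ideal.mem_comap, ← SetLike.mem_coe, hPy]
    simp

theorem assQuot_asympClosure_pow_succ {A : Type} [CommRing A] [IsNoetherianRing A] {I : Ideal A}
    (hI : ∀ p ∈ minimalPrimes A, ¬ I ≤ p) (n : ℕ) :
    assQuot ((I ^ (n + 1)).asympClosure : Set A) =
      assQuot₂ (I ^ n).asympClosure (I ^ (n + 1)).asympClosure := by
  refine Set.Subset.antisymm ?_ ?_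
  · rintro P ⟨hP, c, hc⟩
    refine ⟨hP, c, Ideal.mem_asympClosure_pow_of_forall_mul_mem hI fun a ha ↦ ?_, hc⟩
    have haP : a ∈ P := hP.mem_of_pow_mem (n + 1) (by
      rw [← SetLike.mem_coe, hc]
      exact Ideal.mul_mem_right _ _ (Ideal.le_asympClosure _ (Ideal.pow_mem_pow ha _)))
    rw [← SetLike.mem_coe, hc] at haP
    rwa [mul_comm]
  · rw [assQuot_eq_assQuot₂_univ]
    exact assQuot₂_mono_left (Set.subset_univ _) _

theorem assQuot_asympClosure_pow_mono {A : Type} [CommRing A] [IsNoetherianRing A] {I : Ideal A}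
    (hI : ∀ p ∈ minimalPrimes A, ¬ I ≤ p) (n : ℕ) :
    assQuot ((I ^ n).asympClosure : Set A) ⊆ assQuot ((I ^ (n + 1)).asympClosure : Set A) := by
  rintro P ⟨hP, c, hc⟩
  have hmem : ∀ r, r ∈ P ↔ r * c ∈ (I ^ n).asympClosure := fun r ↦ by
    rw [← SetLike.mem_coe, hc]
    rfl
  obtain ⟨s, hs⟩ := IsNoetherian.noetherian I
  have hle : s.inf (fun a ↦ Submodule.colon (I ^ (n + 1)).asympClosure {c * a}) ≤ P := by
    intro r hr
    rw [hmem]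
    refine Ideal.mem_asympClosure_pow_of_forall_mul_mem hI fun b hb ↦ ?_
    rw [← hs] at hb
    suffices Submodule.span A (s : Set A) ≤
        Submodule.colon (I ^ (n + 1)).asympClosure {r * c} by
      have := this hb
      rwa [Submodule.mem_colon_singleton, smul_eq_mul, mul_comm] at this
    refine Submodule.span_le.mpr fun a ha ↦ ?_
    have := Submodule.mem_colon_singleton.mp ((Finset.inf_le (f := fun a ↦
      Submodule.colon (I ^ (n + 1)).asympClosure {c * a}) ha) hr)
    rw [SetLike.mem_coe, Submodule.mem_colon_singleton]
    convert this using 1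
    simp only [smul_eq_mul]
    ring
  obtain ⟨a, ha, haP⟩ := (Ideal.IsPrime.inf_le' hP).mp hle
  refine ⟨hP, c * a, ?_⟩
  ext r
  refine ⟨fun hr ↦ ?_, fun hr ↦ haP (Submodule.mem_colon_singleton.mpr hr)⟩
  rw [Set.mem_ofPred_eq, ← mul_assoc, pow_succ]
  exact Ideal.mul_mem_asympClosure_mul ((hmem r).mp hr) (hs ▸ Submodule.subset_span ha)

theorem exists_assQuot_asympClosure_pow_eq {A : Type} [CommRing A] [IsNoetherianRing A]
    {I : Ideal A} (hI : ∀ p ∈ minimalPrimes A, ¬ I ≤ p) :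
    ∃ n₀ : ℕ, ∀ n, n₀ ≤ n → assQuot ((I ^ n).asympClosure : Set A) =
      assQuot ((I ^ n₀).asympClosure : Set A) := by
  let f : ℕ → Set (Ideal A) := fun n ↦ assQuot ((I ^ n).asympClosure : Set A)
  have hmono : Monotone f := monotone_nat_of_le_succ (assQuot_asympClosure_pow_mono hI)
  have hfin : (Set.range f).Finite := I.finite_gradedAssociatedPrimes.finite_subsets.subset <| by
    rintro _ ⟨n, rfl⟩ P ⟨hP, c, hc⟩
    refine Ideal.mem_gradedAssociatedPrimes_of_asympClosure hP (n := n) (c := c) fun r ↦ ?_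
    rw [← SetLike.mem_coe, hc]
    rfl
  obtain ⟨_, ⟨n₀, rfl⟩, hmax⟩ := hfin.exists_maximal (Set.range_nonempty f)
  exact ⟨n₀, fun n hn ↦ (hmax ⟨n, rfl⟩ (hmono hn)).antisymm (hmono hn)⟩

namespace Ideal

variable {R : Type} [CommRing R] (N : Type) [AddCommGroup N] [Module R N]

theorem iSup_smul_pow_smul_top_eq (I : Ideal R) (x : R) (k : ℕ) :
    ⨆ i ∈ Finset.Icc 1 (k + 1), x ^ (k + 1 - i) • (I ^ i • (⊤ : Submodule R N)) =
      (I * (I ⊔ span {x}) ^ k) • (⊤ : Submodule R N) := by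
  have hterm : ∀ i, x ^ (k + 1 - i) • (I ^ i • (⊤ : Submodule R N)) =
      (I ^ i * span {x} ^ (k + 1 - i)) • (⊤ : Submodule R N) := fun i ↦ by
    rw [mul_comm, Submodule.mul_smul, span_singleton_pow, Submodule.ideal_span_singleton_smul]
  simp_rw [hterm, ← Submodule.iSup_smul]
  congr 1
  refine le_antisymm (iSup₂_le fun i hi ↦ ?_) ?_
  · obtain ⟨h1, h2⟩ := Finset.mem_Icc.mp hi
    obtain ⟨e, rfl⟩ : ∃ e, i = e + 1 := ⟨i - 1, by omega⟩
    rw [pow_succ', mul_assoc]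
    refine mul_mono_right ?_
    calc I ^ e * span {x} ^ (k + 1 - (e + 1))
        ≤ (I ⊔ span {x}) ^ e * (I ⊔ span {x}) ^ (k + 1 - (e + 1)) :=
          mul_mono (pow_right_mono le_sup_left _) (pow_right_mono le_sup_right _)
      _ = (I ⊔ span {x}) ^ k := by rw [← pow_add]; congr 1; omega
  · rw [← Submodule.add_eq_sup, add_pow, Finset.mul_sum]
    refine Finset.sum_induction _ (· ≤ ⨆ i ∈ Finset.Icc 1 (k + 1), I ^ i * span {x} ^ (k + 1 - i))
      (fun _ _ ↦ sup_le) bot_le fun i hi ↦ ?_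
    have hi := Finset.mem_range.mp hi
    refine le_trans ?_ (le_iSup₂_of_le (i + 1) (Finset.mem_Icc.mpr ⟨by omega, by omega⟩) le_rfl)
    rw [← mul_assoc, ← mul_assoc, ← pow_succ', Nat.add_sub_add_right]
    exact mul_le_left

theorem relIntDep_iff (I : Ideal R) (x : R) :
    I.RelIntDep N x ↔ ∃ k : ℕ, ∀ m : N,
      x ^ (k + 1) • m ∈ (I * (I ⊔ span {x}) ^ k) • (⊤ : Submodule R N) := by
  constructor
  · rintro ⟨_ | k, hk, h⟩
    · exact absurd hk (lt_irrefl 0)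
    · exact ⟨k, by simpa only [iSup_smul_pow_smul_top_eq] using h⟩
  · rintro ⟨k, h⟩
    exact ⟨k + 1, k.succ_pos, by simpa only [iSup_smul_pow_smul_top_eq] using h⟩

theorem isNoetherianRing_quotient_annihilator [IsNoetherian R N] :
    IsNoetherianRing (R ⧸ Module.annihilator R N) := by
  obtain ⟨s, hs⟩ := IsNoetherian.noetherian (⊤ : Submodule R N)
  let f : R →ₗ[R] (s → N) := LinearMap.pi fun i ↦ LinearMap.toSpanSingleton R N i
  have hker : LinearMap.ker f = Module.annihilator R N := by
    ext r
    have hf : f r = 0 ↔ ∀ a ∈ s, r • a = 0 := by simp [f, funext_iff]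
    rw [LinearMap.mem_ker, hf, ← Submodule.annihilator_top, ← hs, Submodule.mem_annihilator_span]
    simp
  have : IsNoetherian R (R ⧸ LinearMap.ker f) :=
    isNoetherian_of_linearEquiv f.quotKerEquivRange.symm
  rw [hker] at this
  exact isNoetherian_of_tower R this

theorem relIntClosure_eq_preimage [IsNoetherian R N] (I : Ideal R) :
    I.relIntClosure N = Quotient.mk (Module.annihilator R N) ⁻¹'
      ((I.map (Quotient.mk (Module.annihilator R N))).asympClosure : Set _) := by
  have := isNoetherianRing_quotient_annihilator (R := R) N
  set φ := Quotient.mk (Module.annihilator R N) with hφ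
  ext x
  have hL : I.map φ ⊔ span {φ x} = (I ⊔ span {x}).map φ := by
    rw [Ideal.map_sup, map_span, Set.image_singleton]
  rw [Set.mem_preimage, SetLike.mem_coe]
  refine (relIntDep_iff N I x).trans ⟨fun ⟨k, hk⟩ ↦ ?_, fun h ↦ ?_⟩
  · set L := I ⊔ span {x} with hLdef
    have hxL : x ∈ L := mem_sup_right (mem_span_singleton_self x)
    have hLL : L ^ (k + 1) • (⊤ : Submodule R N) ≤ (I * L ^ k) • ⊤ := by
      refine (Submodule.smul_mono_left (sup_pow_succ_le I (span {x}) k)).trans ?_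
      rw [Submodule.sup_smul, span_singleton_pow, Submodule.ideal_span_singleton_smul]
      refine sup_le ?_ le_rfl
      intro y hy
      obtain ⟨m, -, rfl⟩ := (Submodule.mem_smul_pointwise_iff_exists _ _ _).mp hy
      exact hk m
    obtain ⟨p, hp, hpc, hp0⟩ := Submodule.FG.exists_monic_coeff_mem_pow_eval_smul_eq_zero
      (IsNoetherian.noetherian (L ^ k • (⊤ : Submodule R N))) (I := I) (x := x) (fun m hm ↦ by
        rw [← Submodule.mul_smul]
        refine hLL ?_
        rw [pow_succ', Submodule.mul_smul]
        exact Submodule.smul_mem_smul hxL hm)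
    have hann : φ (x ^ k * p.eval x) = 0 := by
      rw [hφ, Quotient.eq_zero_iff_mem, Module.mem_annihilator]
      intro m
      rw [mul_comm, mul_smul]
      exact hp0 _ (Submodule.smul_mem_smul (pow_mem_pow hxL k) trivial)
    have h4 : x ^ k * (x * p.eval x - x ^ (p.natDegree + 1)) ∈ I * L ^ (k + p.natDegree) := by
      have := mul_mem_mul (pow_mem_pow hxL k) (mul_eval_sub_pow_mem hp hpc x)
      rwa [mul_left_comm, ← pow_add] at this
    have h5 := mem_map_of_mem φ (neg_mem h4)
    rw [Ideal.map_mul, Ideal.map_pow, ← hL] at h5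
    refine mem_asympClosure_of_isNilpotent h5 ?_
    rw [← map_pow, ← map_sub]
    have : x ^ (k + p.natDegree + 1) - -(x ^ k * (x * p.eval x - x ^ (p.natDegree + 1))) =
        x * (x ^ k * p.eval x) := by ring
    rw [this, map_mul, hann, mul_zero]
    exact IsNilpotent.zero
  · obtain ⟨k, hk⟩ := exists_pow_succ_mem_mul_pow h
    refine ⟨k, fun m ↦ ?_⟩
    rw [hL, ← Ideal.map_pow, ← Ideal.map_mul, ← map_pow] at hk
    obtain ⟨z, hz, hzx⟩ := (mem_map_iff_of_surjective φ Quotient.mk_surjective).mp hk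
    have h1 := Module.mem_annihilator.mp (Quotient.eq.mp hzx) m
    rw [sub_smul, sub_eq_zero] at h1
    rw [← h1]
    exact Submodule.smul_mem_smul hz trivial

end Ideal
/-- `Ass_R R/(I^{n+1})^{(N)}_a = Ass_R (I^n)^{(N)}_a/(I^{n+1})^{(N)}_a` for all `n ≥ 0`;
consequently the sequence `Ass_R (I^n)^{(N)}_a/(I^{n+1})^{(N)}_a`, `n ≥ 1`, is increasing
and ultimately constant. -/
theorem assQuot₂_relIntClosure_pow_succ {R : Type} [CommRing R] (N : Type) [AddCommGroup N]
    [Module R N] [IsNoetherian R N] (I : Ideal R)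
    (hI : ∀ p ∈ (Module.annihilator R N).minimalPrimes, ¬ I ≤ p) :
    (∀ n : ℕ, assQuot ((I ^ (n + 1)).relIntClosure N) =
      assQuot₂ ((I ^ n).relIntClosure N) ((I ^ (n + 1)).relIntClosure N)) ∧
    (∀ n : ℕ, 1 ≤ n →
      assQuot₂ ((I ^ n).relIntClosure N) ((I ^ (n + 1)).relIntClosure N) ⊆
        assQuot₂ ((I ^ (n + 1)).relIntClosure N) ((I ^ (n + 2)).relIntClosure N)) ∧
    ∃ n₀ : ℕ, 1 ≤ n₀ ∧ ∀ n : ℕ, n₀ ≤ n →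
      assQuot₂ ((I ^ n).relIntClosure N) ((I ^ (n + 1)).relIntClosure N) =
        assQuot₂ ((I ^ n₀).relIntClosure N) ((I ^ (n₀ + 1)).relIntClosure N) := by
  set φ := Ideal.Quotient.mk (Module.annihilator R N)
  have := Ideal.isNoetherianRing_quotient_annihilator (R := R) N
  have hsurj : Function.Surjective φ := Ideal.Quotient.mk_surjective
  have hI' : ∀ p ∈ minimalPrimes (R ⧸ Module.annihilator R N), ¬ I.map φ ≤ p := fun p hp h ↦
    hI (p.comap φ) (by
      rw [Ideal.minimalPrimes_eq_comap]
      exact Set.mem_image_of_mem _ hp) (Ideal.map_le_iff_le_comap.mp h)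
  have hcl : ∀ n : ℕ, (I ^ n).relIntClosure N = φ ⁻¹' (I.map φ ^ n).asympClosure :=
    fun n ↦ by rw [Ideal.relIntClosure_eq_preimage, Ideal.map_pow]
  have hassQuot : ∀ n : ℕ, assQuot ((I ^ n).relIntClosure N) =
      Ideal.comap φ '' assQuot (I.map φ ^ n).asympClosure := fun n ↦ by
    rw [hcl, assQuot_eq_assQuot₂_univ, assQuot_eq_assQuot₂_univ, ← assQuot₂_preimage hsurj,
      Set.preimage_univ]
  have hsucc : ∀ n : ℕ, assQuot ((I ^ (n + 1)).relIntClosure N) =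
      assQuot₂ ((I ^ n).relIntClosure N) ((I ^ (n + 1)).relIntClosure N) := fun n ↦ by
    rw [hassQuot, assQuot_asympClosure_pow_succ hI', ← assQuot₂_preimage hsurj, ← hcl, ← hcl]
  refine ⟨hsucc, fun n _ ↦ ?_, ?_⟩
  · rw [← hsucc, ← hsucc, hassQuot, hassQuot]
    exact Set.image_mono (assQuot_asympClosure_pow_mono hI' (n + 1))
  · obtain ⟨n₀, hn₀⟩ := exists_assQuot_asympClosure_pow_eq hI'
    refine ⟨n₀ + 1, by omega, fun n hn ↦ ?_⟩
    rw [← hsucc, ← hsucc, hassQuot, hassQuot, hn₀ (n + 1) (by omega), hn₀ (n₀ + 1 + 1) (by omega)]
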